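/- arXiv:math/0007129 — 3 statements merged into one kernel-verified Lean document; each statement's English description precedes it below -/
import Mathlib

section
/- Let F ≥ 1 be a natural number. The one-cast probability p is antitone on the positive ball of radius F: for all d, d' : Fin F → ℕ with d ≤ d' pointwise and |d'| ≤ F, one has p(d') ≤ p(d). -/
open Finset

/-- The one-cast probability of the combination `d : Fin F → ℕ` (multinomial law):
`p(d) = |d|! / (∏ f, (d f)! · F^{|d|})` where `|d| = ∑ f, d f`. -/
def oneCastProb (F : ℕ) (d : Fin F → ℕ) : ℚ :=
  (Nat.factorial (∑ f, d f) : ℚ) /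
    ((∏ f, Nat.factorial (d f) : ℕ) * (F : ℚ) ^ (∑ f, d f))

theorem sum_update_succ {F : ℕ} (d : Fin F → ℕ) (i : Fin F) :
    ∑ f, Function.update d i (d i + 1) f = ∑ f, d f + 1 := by
  rw [Finset.sum_update_of_mem (Finset.mem_univ i),
    Finset.sdiff_singleton_eq_erase, ← Finset.add_sum_erase _ d (Finset.mem_univ i)]
  ring

theorem prod_factorial_update_succ {F : ℕ} (d : Fin F → ℕ) (i : Fin F) :
    ∏ f, Nat.factorial (Function.update d i (d i + 1) f) =
      (d i + 1) * ∏ f, Nat.factorial (d f) := by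
  rw [← Finset.mul_prod_erase _ _ (Finset.mem_univ i),
    ← Finset.mul_prod_erase _ (fun f => Nat.factorial (d f)) (Finset.mem_univ i),
    Function.update_self, Nat.factorial_succ, mul_assoc]
  congr 2
  refine Finset.prod_congr rfl fun f hf => ?_
  rw [Function.update_of_ne (Finset.ne_of_mem_erase hf)]

/-- Adding one die showing face `i` does not increase the one-cast probability, as long as the
number of dice stays at most `F`. -/
theorem oneCastProb_update_succ_le {F : ℕ} (d : Fin F → ℕ) (i : Fin F)
    (h : ∑ f, d f + 1 ≤ F) :
    oneCastProb F (Function.update d i (d i + 1)) ≤ oneCastProb F d := by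
  have hF : (0 : ℚ) < F := by exact_mod_cast (by omega : 0 < F)
  have hP : (0 : ℚ) < (∏ f, Nat.factorial (d f) : ℕ) := by
    exact_mod_cast Finset.prod_pos fun f _ => Nat.factorial_pos (d f)
  unfold oneCastProb
  rw [sum_update_succ, prod_factorial_update_succ, Nat.factorial_succ, pow_succ,
    div_le_div_iff₀ (by positivity) (by positivity)]
  have key : ((∑ f, d f + 1 : ℕ) : ℚ) ≤ ((d i + 1 : ℕ) : ℚ) * F := by
    exact_mod_cast h.trans (Nat.le_mul_of_pos_left F (Nat.succ_pos (d i)))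
  have hc : (0 : ℚ) ≤ (Nat.factorial (∑ f, d f) : ℚ) *
      ((∏ f, Nat.factorial (d f) : ℕ) * (F : ℚ) ^ (∑ f, d f)) := by positivity
  have hmul := mul_le_mul_of_nonneg_right key hc
  rw [Nat.cast_mul, Nat.cast_mul]
  linarith

/-- The one-cast probability `p` is antitone on the positive ball of radius `F`:
if `d ≤ d'` pointwise and `|d'| ≤ F`, then `p(d') ≤ p(d)`. -/
theorem stmt_3 (F : ℕ) (hF : 1 ≤ F) :
    ∀ d d' : Fin F → ℕ, d ≤ d' → (∑ f, d' f) ≤ F →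
      oneCastProb F d' ≤ oneCastProb F d := by
  intro d d' hle hd'
  obtain ⟨n, hn⟩ := Nat.exists_eq_add_of_le (Finset.sum_le_sum fun f (_ : f ∈ univ) => hle f)
  induction n generalizing d with
  | zero =>
    have heq : d = d' := funext fun f =>
      (Finset.sum_eq_sum_iff_of_le fun f _ => hle f).1 hn.symm f (Finset.mem_univ f)
    rw [heq]
  | succ n ih =>
    obtain ⟨i, -, hi⟩ := Finset.exists_lt_of_sum_lt (show ∑ f, d f < ∑ f, d' f by omega)
    refine (ih (Function.update d i (d i + 1)) ?_ ?_).trans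
      (oneCastProb_update_succ_le d i (by omega))
    · exact update_le_iff.2 ⟨hi, fun f _ => hle f⟩
    · rw [sum_update_succ]
      omega
end

section
/- Let F ≥ 2 and D be natural numbers. The one-cast probability p is antitone on the positive ball of radius D if and only if D ≤ F; that is, (∀ d d' : Fin F → ℕ, d ≤ d' → |d'| ≤ D → p(d') ≤ p(d)) ↔ D ≤ F. -/
open Finset

/-- Adding one die showing face `i` multiplies the one-cast probability by
`(|d| + 1) / (F (d i + 1))`. -/
theorem oneCastProb_add_single {F : ℕ} (hF : 0 < F) (d : Fin F → ℕ) (i : Fin F) :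
    oneCastProb F (d + Pi.single i 1) =
      oneCastProb F d * (((∑ f, d f : ℕ) + 1) / (F * (d i + 1))) := by
  have hsum : ∑ f, (d + Pi.single i 1 : Fin F → ℕ) f = (∑ f, d f) + 1 := by
    simp [Finset.sum_add_distrib]
  have hprod : ∏ f, Nat.factorial ((d + Pi.single i 1 : Fin F → ℕ) f)
      = (∏ f, Nat.factorial (d f)) * (d i + 1) := by
    rw [← Finset.mul_prod_erase univ _ (mem_univ i),
      ← Finset.mul_prod_erase univ (fun f => Nat.factorial (d f)) (mem_univ i)]
    have h : ∏ f ∈ univ.erase i, Nat.factorial ((d + Pi.single i 1 : Fin F → ℕ) f)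
        = ∏ f ∈ univ.erase i, Nat.factorial (d f) := by
      refine Finset.prod_congr rfl fun f hf => ?_
      simp [Finset.ne_of_mem_erase hf]
    rw [h]
    simp only [Pi.add_apply, Pi.single_eq_same, Nat.factorial_succ]
    ring
  have hF' : (F : ℚ) ≠ 0 := by positivity
  have hp : ((∏ f, Nat.factorial (d f) : ℕ) : ℚ) ≠ 0 := by
    exact_mod_cast Finset.prod_ne_zero_iff.2 fun f _ => Nat.factorial_ne_zero (d f)
  have hd : (d i : ℚ) + 1 ≠ 0 := by positivity
  unfold oneCastProb
  rw [hsum, hprod, Nat.factorial_succ, Nat.cast_mul, Nat.cast_mul, pow_succ]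
  generalize (∏ f, Nat.factorial (d f) : ℕ) = P at *
  generalize (∑ f, d f : ℕ) = S at *
  push_cast
  field_simp

theorem oneCastProb_pos {F : ℕ} (hF : 0 < F) (d : Fin F → ℕ) : 0 < oneCastProb F d := by
  have hp : 0 < ∏ f, Nat.factorial (d f) :=
    Finset.prod_pos fun f _ => Nat.factorial_pos (d f)
  have hs := Nat.factorial_pos (∑ f, d f)
  unfold oneCastProb
  generalize (∏ f, Nat.factorial (d f) : ℕ) = P at *
  positivity

theorem oneCastProb_add_single_le {F : ℕ} (d : Fin F → ℕ) (i : Fin F)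
    (h : (∑ f, d f) + 1 ≤ F) : oneCastProb F (d + Pi.single i 1) ≤ oneCastProb F d := by
  have hF : 0 < F := by lia
  rw [oneCastProb_add_single hF]
  refine mul_le_of_le_one_right (oneCastProb_pos hF d).le ?_
  rw [div_le_one (by positivity)]
  exact_mod_cast h.trans (Nat.le_mul_of_pos_right F (Nat.succ_pos (d i)))

theorem oneCastProb_le_of_le {F : ℕ} {d d' : Fin F → ℕ} (hd : d ≤ d')
    (h : ∑ f, d' f ≤ F) : oneCastProb F d' ≤ oneCastProb F d := by
  induction hn : (∑ f, d' f) - ∑ f, d f generalizing d with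
  | zero =>
    have hle : ∑ f, d f ≤ ∑ f, d' f := Finset.sum_le_sum fun f _ => hd f
    have heq : d = d' := funext fun f =>
      (Finset.sum_eq_sum_iff_of_le fun f _ => hd f).1 (by lia) f (mem_univ f)
    rw [heq]
  | succ n ih =>
    obtain ⟨i, -, hi⟩ : ∃ i ∈ univ, d i < d' i :=
      Finset.exists_lt_of_sum_lt (by lia)
    have hsum : ∑ f, (d + Pi.single i 1 : Fin F → ℕ) f = (∑ f, d f) + 1 := by
      simp [Finset.sum_add_distrib]
    refine (ih (d := d + Pi.single i 1) (fun f => ?_) (by lia)).trans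
      (oneCastProb_add_single_le d i (by lia))
    by_cases hf : f = i
    · subst hf
      simpa using hi
    · simpa [hf] using hd f

/-- For `F ≥ 2`, the one-cast probability `p` is antitone on the positive ball
`B⁺(D)` if and only if `D ≤ F`. -/
theorem stmt_4 (F D : ℕ) (hF : 2 ≤ F) :
    (∀ d d' : Fin F → ℕ, d ≤ d' → (∑ f, d' f) ≤ D →
      oneCastProb F d' ≤ oneCastProb F d) ↔ D ≤ F := by
  refine ⟨fun H => ?_, fun hD d d' hd hs => oneCastProb_le_of_le hd (hs.trans hD)⟩
  by_contra! hD
  let i : Fin F := ⟨0, by lia⟩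
  let j : Fin F := ⟨1, by lia⟩
  have hij : j ≠ i := by simp [i, j]
  let d : Fin F → ℕ := Pi.single i F
  have hsum : ∑ f, d f = F := by simp [d]
  have hj : d j = 0 := by simp [d, hij]
  have hle := H d (d + Pi.single j 1) (le_add_of_nonneg_right zero_le)
    (by simp only [Pi.add_apply, Finset.sum_add_distrib, hsum]; simpa using hD)
  have hF0 : 0 < F := by lia
  rw [oneCastProb_add_single hF0, hsum, hj] at hle
  refine hle.not_gt (lt_mul_of_one_lt_right (oneCastProb_pos hF0 d) ?_)
  rw [one_lt_div (by positivity)]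
  simp
end

section
/- Consider the action of the symmetric group of Fin 6 on pairs of multisets over Fin 6, acting by relabeling the faces simultaneously in both components: π • (m₁, m₂) = (map π m₁, map π m₂). The number of orbits of pairs (m₁, m₂) with card m₁ = card m₂ = 3 under this action is exactly 31. -/
open Finset

theorem map_univ_val_eq_map_univ_val_iff {α β : Type*} [Fintype α] [DecidableEq β]
    {f g : α → β} :
    univ.val.map f = univ.val.map g ↔ ∃ π : Equiv.Perm α, f = g ∘ π := by
  constructor
  · intro h
    have card_fiber (k : α → β) (b : β) :
        Fintype.card {a // k a = b} = (univ.val.map k).count b := by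
      rw [Fintype.card_subtype, Multiset.count_map, card_def, filter_val]
      simp only [eq_comm]
    have e (b : β) : {a // f a = b} ≃ {a // g a = b} :=
      Fintype.equivOfCardEq (by rw [card_fiber, card_fiber, h])
    exact ⟨Equiv.ofFiberEquiv e, funext fun a => (Equiv.ofFiberEquiv_map e a).symm⟩
  · rintro ⟨π, rfl⟩
    rw [← Multiset.map_map, Multiset.map_univ_val_equiv]

/-- The couples of occupation numbers of a couple of combinations, forgetting the faces. -/
def occupationNumbers {α : Type*} [Fintype α] [DecidableEq α] {m n : ℕ}
    (x : Sym α m × Sym α n) : Multiset (ℕ × ℕ) :=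
  univ.val.map fun i => ((x.1 : Multiset α).count i, (x.2 : Multiset α).count i)

theorem exists_map_perm_eq_iff {α : Type*} [Fintype α] [DecidableEq α] {m n : ℕ}
    (x y : Sym α m × Sym α n) :
    (∃ π : Equiv.Perm α, (x.1.map π, x.2.map π) = y) ↔
      occupationNumbers x = occupationNumbers y := by
  rw [occupationNumbers, occupationNumbers, map_univ_val_eq_map_univ_val_iff]
  refine exists_congr fun π => ?_
  have count_map (s : Multiset α) (i : α) : (s.map π).count (π i) = s.count i :=
    Multiset.count_map_eq_count' π s π.injective i
  have map_eq_iff (s t : Multiset α) : s.map π = t ↔ ∀ i, s.count i = t.count (π i) := by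
    rw [Multiset.ext, ← π.forall_congr_right]
    simp only [count_map]
  simp only [Prod.ext_iff, ← Sym.coe_inj, Sym.coe_map, map_eq_iff, funext_iff,
    Function.comp_apply, forall_and]

theorem filter_exists_map_perm_eq_iff {α : Type*} [Fintype α] [DecidableEq α] {m n : ℕ}
    (x y : Sym α m × Sym α n) :
    univ.filter (fun z : Sym α m × Sym α n =>
        ∃ π : Equiv.Perm α, (x.1.map π, x.2.map π) = z) =
      univ.filter (fun z : Sym α m × Sym α n =>
        ∃ π : Equiv.Perm α, (y.1.map π, y.2.map π) = z) ↔
      occupationNumbers x = occupationNumbers y := by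
  simp only [exists_map_perm_eq_iff, Finset.ext_iff, mem_filter_univ]
  exact ⟨fun h => (h y).2 rfl, fun h z => by rw [h]⟩

theorem card_image_congr_of_eq_iff {α β γ : Type*} [DecidableEq β] [DecidableEq γ]
    (s : Finset α) {f : α → β} {g : α → γ} (h : ∀ x y, f x = f y ↔ g x = g y) :
    (s.image f).card = (s.image g).card := by
  have card_eq_left : (s.image fun x => (f x, g x)).card = (s.image f).card := by
    rw [← card_image_of_injOn (f := Prod.fst), image_image]
    · rfl
    · simp only [Set.InjOn, coe_image, Set.forall_mem_image]
      exact fun x _ y _ hxy => Prod.ext hxy ((h x y).1 hxy)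
  have card_eq_right : (s.image fun x => (f x, g x)).card = (s.image g).card := by
    rw [← card_image_of_injOn (f := Prod.snd), image_image]
    · rfl
    · simp only [Set.InjOn, coe_image, Set.forall_mem_image]
      exact fun x _ y _ hxy => Prod.ext ((h x y).2 hxy) hxy
  exact card_eq_left.symm.trans card_eq_right

/-- Representatives of the three-die combinations up to relabeling of the faces. -/
def threeDieRepresentatives : Finset (Sym (Fin 6) 3) :=
  {⟨{0, 0, 0}, rfl⟩, ⟨{0, 0, 1}, rfl⟩, ⟨{0, 1, 2}, rfl⟩}

theorem exists_map_threeDieRepresentative_eq (s : Sym (Fin 6) 3) :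
    ∃ r ∈ threeDieRepresentatives, ∃ π : Equiv.Perm (Fin 6), r.map π = s := by
  have key : ∀ s : Sym (Fin 6) 3, ∃ r ∈ threeDieRepresentatives,
      occupationNumbers (r, r) = occupationNumbers (s, s) := by
    decide +kernel
  obtain ⟨r, hr, h⟩ := key s
  obtain ⟨π, hπ⟩ := (exists_map_perm_eq_iff _ _).2 h
  exact ⟨r, hr, π, congrArg Prod.fst hπ⟩

theorem image_occupationNumbers_univ :
    univ.image (occupationNumbers : Sym (Fin 6) 3 × Sym (Fin 6) 3 → _) =
      (threeDieRepresentatives ×ˢ (univ : Finset (Sym (Fin 6) 3))).image occupationNumbers := by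
  refine (image_subset_iff.2 fun x _ => ?_).antisymm (image_subset_image (subset_univ _))
  obtain ⟨r, hr, π, hπ⟩ := exists_map_threeDieRepresentative_eq x.1
  refine mem_image.2 ⟨(r, x.2.map π.symm), mem_product.2 ⟨hr, mem_univ _⟩, ?_⟩
  refine (exists_map_perm_eq_iff _ _).1 ⟨π, Prod.ext hπ ?_⟩
  simp [Sym.map_map]

theorem card_image_occupationNumbers :
    (univ.image (occupationNumbers : Sym (Fin 6) 3 × Sym (Fin 6) 3 → _)).card = 31 := by
  rw [image_occupationNumbers_univ]
  decide +kernel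

/-- A three-die combination with 6 faces is a multiset over `Fin 6` of
cardinality 3, i.e. an element of `Sym (Fin 6) 3`. The symmetric group of
`Fin 6` acts on couples of combinations by relabeling the faces simultaneously
in both components. The number of orbits — i.e. the number of distinct orbit
sets `{(m₁.map π, m₂.map π) | π}` — is exactly 31. -/
theorem stmt_12 :
    (Finset.univ.image
        (fun x : Sym (Fin 6) 3 × Sym (Fin 6) 3 =>
          Finset.univ.filter
            (fun y : Sym (Fin 6) 3 × Sym (Fin 6) 3 =>
              ∃ π : Equiv.Perm (Fin 6), (x.1.map π, x.2.map π) = y))).card = 31 := by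
  rw [card_image_congr_of_eq_iff univ filter_exists_map_perm_eq_iff]
  exact card_image_occupationNumbers
end
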